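/- Let D be a chord diagram with n chords and let 0 ≤ m ≤ n. After the change of variable λ = d − 2, the coefficient of d^{n−m} in the polynomial W_J(D) equals 2^m Σ_K (−1)^{a(K)}, where the sum is over all acceptable objects K for LID(D) with deg₄(K) = m. -/

import Mathlib

open Finset

/-! ### Permanents -/

/-- The permanent of a square matrix. -/
noncomputable def perm {ι R : Type*} [Fintype ι] [DecidableEq ι] [CommRing R]
    (M : Matrix ι ι R) : R :=
  ∑ σ : Equiv.Perm ι, ∏ i, M i (σ i)

/-! ### Chord diagrams -/

/-- A chord diagram with `n` chords: a partition of `{1,…,2n}` into `n` two-element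
subsets (chords), each recorded by its left endpoint `l i` and right endpoint `r i`,
with the chords numbered in increasing order of their left endpoints. -/
structure ChordDiagram (n : ℕ) where
  l : Fin n → Fin (2 * n)
  r : Fin n → Fin (2 * n)
  lr : ∀ i, l i < r i
  mono : StrictMono l
  cover : ∀ q : Fin (2 * n), ∃! i : Fin n, l i = q ∨ r i = q

namespace ChordDiagram

variable {n : ℕ}

/-- Chords `i` and `j` intersect. -/
abbrev Intersect (D : ChordDiagram n) (i j : Fin n) : Prop :=
  (D.l i < D.l j ∧ D.l j < D.r i ∧ D.r i < D.r j) ∨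
  (D.l j < D.l i ∧ D.l i < D.r j ∧ D.r j < D.r i)

/-- Chord `i` is completely contained in chord `j`. -/
abbrev Contained (D : ChordDiagram n) (i j : Fin n) : Prop :=
  D.l j < D.l i ∧ D.r i < D.r j

/-- The five colors `I, B⁺₀, B⁺₁, B⁻₀, B⁻₁` (`true` encodes subscript `1`). -/
inductive JCol where
  | I : JCol
  | Bp : Bool → JCol
  | Bm : Bool → JCol
  deriving DecidableEq, Fintype

/-- The contribution `δ` of a left endpoint of a chord with a given color. -/
def lsign : JCol → ℤ
  | .Bp true => 1
  | .Bm true => -1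
  | _ => 0

/-- `δ(q)` for a coloring `ρ` of the chords of `D`. -/
def delta (D : ChordDiagram n) (ρ : Fin n → JCol) (q : Fin (2 * n)) : ℤ :=
  ∑ v : Fin n, ((if D.l v = q then lsign (ρ v) else 0) +
                (if D.r v = q then - lsign (ρ v) else 0))

/-- `Σ_{q < p} δ(q)`. -/
def kOf (D : ChordDiagram n) (ρ : Fin n → JCol) (p : Fin (2 * n)) : ℤ :=
  ∑ q ∈ univ.filter (fun q => q < p), D.delta ρ q

/-- The weight `ω_ρ(v)` of chord `v` under the coloring `ρ`. -/
noncomputable def omega (D : ChordDiagram n) (ρ : Fin n → JCol) (v : Fin n) :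
    Polynomial ℚ :=
  match ρ v with
  | .I => Polynomial.X + 2
  | .Bp ε => - (-1 : Polynomial ℚ) ^ (if ε then 1 else 0) *
      (1 + ((D.kOf ρ (D.l v) : ℤ) : Polynomial ℚ)) *
      (Polynomial.X + 1 - ((D.kOf ρ (D.r v) : ℤ) : Polynomial ℚ))
  | .Bm ε => - (-1 : Polynomial ℚ) ^ (if ε then 1 else 0) *
      (1 + ((D.kOf ρ (D.r v) : ℤ) : Polynomial ℚ)) *
      (Polynomial.X + 1 - ((D.kOf ρ (D.l v) : ℤ) : Polynomial ℚ))

/-- The colored Jones weight system `W_J(D) ∈ ℚ[λ]` (with `λ = X`). -/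
noncomputable def WJ (D : ChordDiagram n) : Polynomial ℚ :=
  ∑ ρ : Fin n → JCol, ∏ v : Fin n, D.omega ρ v

/-- The intersection matrix `IM(D)` with entries `sign(i−j)` for intersecting chords. -/
def IM (D : ChordDiagram n) : Matrix (Fin n) (Fin n) ℚ := fun i j =>
  if D.Intersect i j then (if j < i then 1 else if i < j then -1 else 0) else 0

/-- The `3×3` block `A₀`. -/
noncomputable def A0 : Matrix (Fin 3) (Fin 3) (Polynomial ℚ) :=
  !![Polynomial.X + 2, 0, 0; 0, Polynomial.X + 2, 1; Polynomial.X, -Polynomial.X - 2, 1]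

/-- The `3×3` block `A₊`. -/
noncomputable def Aplus : Matrix (Fin 3) (Fin 3) (Polynomial ℚ) := !![1, 1, 0; 0, 0, 0; 0, 0, 0]

/-- The `3×3` block `A₋`. -/
noncomputable def Aminus : Matrix (Fin 3) (Fin 3) (Polynomial ℚ) := !![0, 0, 0; -1, -1, 0; 0, 0, 0]

/-- The `3×3` block `A_c`. -/
noncomputable def Acont : Matrix (Fin 3) (Fin 3) (Polynomial ℚ) := !![1, 1, 0; -1, -1, 0; 0, 0, 0]

/-- The blown-up intersection matrix `IM_J(D)`, a `3n×3n` matrix of `3×3` blocks. -/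
noncomputable def IMJ (D : ChordDiagram n) :
    Matrix (Fin n × Fin 3) (Fin n × Fin 3) (Polynomial ℚ) := fun p q =>
  (if p.1 = q.1 then A0
   else if q.1 < p.1 ∧ D.Intersect p.1 q.1 then Aplus
   else if p.1 < q.1 ∧ D.Intersect p.1 q.1 then Aminus
   else if ¬ D.Intersect p.1 q.1 ∧ D.Contained p.1 q.1 then Acont
   else 0) p.2 q.2

end ChordDiagram

/-! ### Looped digraphs -/

/-- A looped digraph: a finite digraph (arcs a set of ordered pairs) with a loop at
every vertex and a distinguished set of red non-loop arcs. -/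
structure LoopedDigraph (V : Type*) [Fintype V] [DecidableEq V] where
  arcs : Finset (V × V)
  red : Finset (V × V)
  loop_mem : ∀ v : V, (v, v) ∈ arcs
  red_sub : red ⊆ arcs
  red_no_loop : ∀ v : V, (v, v) ∉ red

/-- A thickened arc `(e, b)`, where `e` is an arc of the digraph and `b : Bool` records:
for an uncolored arc, whether it is thickened at its tail (`true`) or head (`false`);
for a red arc (always thickened at its tail `e.1`), whether it keeps its original
orientation (`true`) or is reversed (`false`). Loops always carry `b = true`. -/
abbrev TArc (V : Type*) := (V × V) × Bool

variable {V : Type*} [Fintype V] [DecidableEq V]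

/-- The degree of `v` in a collection `K` of thickened arcs: the number of arc-ends of
`K` at `v` (a loop contributing `2`). -/
def degAt (K : Finset (TArc V)) (v : V) : ℕ :=
  ∑ t ∈ K, ((if t.1.1 = v then 1 else 0) + (if t.1.2 = v then 1 else 0))

/-- `deg₄(K)`: the number of vertices of degree `4` in `K`. -/
def deg4 (K : Finset (TArc V)) : ℕ := (univ.filter fun v => degAt K v = 4).card

namespace LoopedDigraph

variable (G : LoopedDigraph V)

/-- The initial vertex of a thickened arc, as oriented in the collection. -/
def src (t : TArc V) : V := if t.1 ∈ G.red ∧ t.2 = false then t.1.2 else t.1.1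

/-- The terminal vertex of a thickened arc, as oriented in the collection. -/
def dst (t : TArc V) : V := if t.1 ∈ G.red ∧ t.2 = false then t.1.1 else t.1.2

/-- The vertex at which a thickened arc is thickened. -/
def tvert (t : TArc V) : V := if t.1 ∈ G.red then t.1.1 else if t.2 then t.1.1 else t.1.2

/-- The number of arcs of `K` thickened at `v`. -/
def thickAt (K : Finset (TArc V)) (v : V) : ℕ := (K.filter fun t => G.tvert t = v).card

/-- The number of arcs of `K` thickened at `v` that leave `v` (a loop counting as
leaving). -/
def outThickAt (K : Finset (TArc V)) (v : V) : ℕ :=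
  (K.filter fun t => G.tvert t = v ∧ G.src t = v).card

/-- An acceptable object for a looped digraph. -/
structure IsAcceptable (K : Finset (TArc V)) : Prop where
  mem_arcs : ∀ t ∈ K, t.1 ∈ G.arcs
  loop_thick : ∀ t ∈ K, t.1.1 = t.1.2 → t.2 = true
  deg024 : ∀ v, degAt K v = 0 ∨ degAt K v = 2 ∨ degAt K v = 4
  half_thick : ∀ v, 2 * G.thickAt K v = degAt K v
  balance : ∀ v, G.thickAt K v = 2 → G.outThickAt K v = 1

/-- `a(K)`: the number of arcs of `K` thickened at their initial vertex (loops count). -/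
def aK (K : Finset (TArc V)) : ℕ := (K.filter fun t => G.src t = G.tvert t).card

open Classical in
/-- The partition function `J(G)`, with `λ ↦ lam` and `x_e ↦ x e`. -/
noncomputable def J {R : Type*} [CommRing R] (lam : R) (x : V × V → R) : R :=
  ∑ K : Finset (TArc V),
    if G.IsAcceptable K then
      2 ^ deg4 K * (lam + 2) ^ (Fintype.card V - deg4 K) *
        (∏ t ∈ K, x t.1) * (-1 : R) ^ G.aK K
    else 0

/-- `s(w) = δ_w · ε_w` for a partial coloring `c` (with support the set `V′`). -/
def sInt (c : V → Option (Bool × Bool)) (w : V) : ℤ :=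
  match c w with
  | none => 0
  | some (δ, ε) => (if δ then 1 else -1) * (if ε then 1 else 0)

/-- `z_v(e)` (for `bar = false`) and `z̄_v(e)` (for `bar = true`). -/
def zfun {R : Type*} [CommRing R] (x : V × V → R) (c : V → Option (Bool × Bool))
    (bar : Bool) (v : V) (e : V × V) : R :=
  match c v with
  | none => 0
  | some (δ, _) =>
    if e ∈ G.red then
      (if e.1 = v then ((sInt c e.2 : ℤ) : R) * x e else 0)
    else if e.1 = v then (if δ = bar then ((sInt c e.2 : ℤ) : R) * x e else 0)
    else if e.2 = v then (if δ ≠ bar then ((sInt c e.1 : ℤ) : R) * x e else 0)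
    else 0

/-- The weight `ω′_c(v)`. -/
noncomputable def omegaC {R : Type*} [CommRing R] (lam : R) (x : V × V → R)
    (c : V → Option (Bool × Bool)) (v : V) : R :=
  match c v with
  | none => 0
  | some (_, ε) =>
    - (-1 : R) ^ (if ε then 1 else 0) *
      (1 + ∑ e ∈ G.arcs, G.zfun x c false v e) *
      (lam + 1 - ∑ e ∈ G.arcs, G.zfun x c true v e)

/-- The state sum `J′(G)`: the sum over `V′ ⊆ V` and colorings `c` of `V′` is encoded
as a sum over partial colorings `c : V → Option (Bool × Bool)` with support `V′`. -/
noncomputable def J' {R : Type*} [CommRing R] (lam : R) (x : V × V → R) : R :=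
  ∑ c : V → Option (Bool × Bool),
    (lam + 2) ^ (univ.filter fun v => c v = none).card *
      ∏ v ∈ univ.filter (fun v => (c v).isSome = true), G.omegaC lam x c v

end LoopedDigraph

/-! ### The labeled intersection digraph of a chord diagram -/

open ChordDiagram in
/-- The labeled intersection digraph `LID(D)` of a chord diagram `D`. -/
def LID {n : ℕ} (D : ChordDiagram n) : LoopedDigraph (Fin n) where
  arcs := univ.filter fun p : Fin n × Fin n =>
    p.1 = p.2 ∨ (p.1 < p.2 ∧ D.Intersect p.1 p.2) ∨ D.Contained p.1 p.2
  red := univ.filter fun p : Fin n × Fin n => D.Contained p.1 p.2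
  loop_mem := by intro v; simp
  red_sub := by intro p hp; simp only [mem_filter, mem_univ, true_and] at hp ⊢; tauto
  red_no_loop := by
    intro v hv
    simp only [mem_filter, mem_univ, true_and] at hv
    exact lt_irrefl _ hv.1

/-! ### The data `(V′, h)` and the state sum `A(V′, h)` -/

/-- The data of a function `h` assigning to every `v ∈ V′` a set of at most two arcs of
`G` incident with `v`, every red arc of `h v` leaving `v` (and `h v = ∅` off `V′`). -/
structure HData (G : LoopedDigraph V) (V' : Finset V) where
  h : V → Finset (V × V)
  sub : ∀ v, h v ⊆ G.arcs
  card_le : ∀ v, (h v).card ≤ 2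
  incident : ∀ v, ∀ e ∈ h v, e.1 = v ∨ e.2 = v
  red_out : ∀ v, ∀ e ∈ h v, e ∈ G.red → e.1 = v
  outside : ∀ v, v ∉ V' → h v = ∅

/-- The number of arc-ends at `v` among a set of thickened arcs `(e, w)`. -/
def endCountAt (S : Finset ((V × V) × V)) (v : V) : ℕ :=
  ∑ p ∈ S, ((if p.1.1 = v then 1 else 0) + (if p.1.2 = v then 1 else 0))

namespace HData

variable {G : LoopedDigraph V} {V' : Finset V} (H : HData G V')

/-- `W₁ = {v ∈ V′ : |h(v)| = 2}`. -/
def W1 : Finset V := V'.filter fun v => (H.h v).card = 2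

/-- `W₂ = {v ∈ V′ : |h(v)| ≥ 1}`. -/
def W2 : Finset V := V'.filter fun v => 1 ≤ (H.h v).card

/-- `h(W₂)`: the set of thickened arcs `(e, v)` with `v ∈ W₂` and `e ∈ h v`. -/
def hW2 : Finset ((V × V) × V) :=
  univ.filter fun p => p.2 ∈ H.W2 ∧ p.1 ∈ H.h p.2

/-- The functions `g` on `S` with `g v ∈ h v`, encoded as singleton-valued selections
`gs : V → Finset (V × V)` (with `gs v = ∅` off `S`). -/
def choices (S : Finset V) : Finset (V → Finset (V × V)) :=
  univ.filter fun gs => ∀ v, gs v ⊆ H.h v ∧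
    (v ∈ S → (gs v).card = 1) ∧ (v ∉ S → gs v = ∅)

/-- The summand `B(c, V₂′, g)`; here `g` is encoded by the selection `gs` on
`W₁ ∪ V₂′` and the complementary function `f` (on `W₁ ∪ V₁′`, `V₁′ = W₂∖(W₁∪V₂′)`)
is encoded by the complementary selection `h v ∖ gs v`. -/
noncomputable def Bterm {R : Type*} [CommRing R] (lam : R) (x : V × V → R)
    (c : V → Option (Bool × Bool)) (V2 : Finset V) (gs : V → Finset (V × V)) : R :=
  (-1 : R) ^ (∑ v ∈ V', ((c v).elim 0 fun p => if p.2 then 1 else 0 : ℕ)) *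
  (-1 : R) ^ (H.W1 ∪ V2).card *
  (lam + 1) ^ (V' \ (H.W1 ∪ V2)).card *
  (∏ v ∈ H.W1 ∪ V2, ∏ e ∈ gs v, G.zfun x c true v e) *
  (∏ v ∈ H.W1 ∪ (H.W2 \ (H.W1 ∪ V2)), ∏ e ∈ H.h v \ gs v, G.zfun x c false v e)

open Classical in
/-- The state sum `A(V′, h)`. -/
noncomputable def Aval {R : Type*} [CommRing R] (lam : R) (x : V × V → R) : R :=
  ∑ c : V → Option (Bool × Bool),
    if (∀ v, (c v).isSome = true ↔ v ∈ V') then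
      ∑ V2 ∈ (H.W2 \ H.W1).powerset, ∑ gs ∈ H.choices (H.W1 ∪ V2),
        H.Bterm lam x c V2 gs
    else 0

end HData

/-! ### Good collections and the state sum `C(X, V′, K)` -/

namespace LoopedDigraph

/-- A collection of thickened arcs good on `V′`. -/
structure IsGood (G : LoopedDigraph V) (V' : Finset V) (K : Finset (TArc V)) : Prop where
  mem_arcs : ∀ t ∈ K, t.1 ∈ G.arcs
  loop_thick : ∀ t ∈ K, t.1.1 = t.1.2 → t.2 = true
  red_orig : ∀ t ∈ K, t.1 ∈ G.red → t.2 = true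
  deg_mem : ∀ v ∈ V', degAt K v = 2 ∨ degAt K v = 4
  deg_out : ∀ v, v ∉ V' → degAt K v = 0
  half_thick : ∀ v, 2 * G.thickAt K v = degAt K v
  unc_opp : ∀ t ∈ K, ∀ s ∈ K, t ≠ s → t.1 ∉ G.red → s.1 ∉ G.red →
    G.tvert t = G.tvert s → ((G.src t = G.tvert t) ↔ ¬ (G.src s = G.tvert s))

/-- The set `W₁` of degree-4 vertices of a collection `K`. -/
def KW1 (G : LoopedDigraph V) (K : Finset (TArc V)) : Finset V :=
  univ.filter fun v => degAt K v = 4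

/-- The arcs of `K` thickened at `v`. -/
def thickedAt (G : LoopedDigraph V) (K : Finset (TArc V)) (v : V) : Finset (TArc V) :=
  K.filter fun t => G.tvert t = v

/-- The functions `g′` assigning to each degree-4 vertex one of the two arcs of `K`
thickened at it, encoded as singleton-valued selections. -/
def kchoices (G : LoopedDigraph V) (K : Finset (TArc V)) : Finset (V → Finset (TArc V)) :=
  univ.filter fun cs => ∀ v, cs v ⊆ G.thickedAt K v ∧
    (v ∈ KW1 G K → (cs v).card = 1) ∧ (v ∉ KW1 G K → cs v = ∅)

open Classical in
/-- The state sum `C(X, V′, K)`. -/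
noncomputable def Cval {R : Type*} [CommRing R] (G : LoopedDigraph V) (V' : Finset V)
    (K : Finset (TArc V)) (X : Finset V) (x : V × V → R) : R :=
  ∑ cs ∈ kchoices G K,
    (-1 : R) ^ (KW1 G K).card * (-1 : R) ^ X.card *
    ∑ c : V → Option (Bool × Bool),
      if (∀ v, (c v).isSome = true ↔ v ∈ V') then
        (∏ v ∈ KW1 G K ∪ X,
          ∏ t ∈ (if v ∈ KW1 G K then cs v else G.thickedAt K v), G.zfun x c true v t.1) *
        (∏ v ∈ V' \ X, ∏ t ∈ G.thickedAt K v \ cs v, G.zfun x c false v t.1)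
      else 0

/-- A connected acceptable object: one with no single loops. -/
def IsConnectedObj (G : LoopedDigraph V) (K : Finset (TArc V)) : Prop :=
  G.IsAcceptable K ∧ ∀ t ∈ K, t.1.1 = t.1.2 → degAt K t.1.1 ≠ 2

/-- A super acceptable object: connected, and every vertex has degree at least 2. -/
def IsSuper (G : LoopedDigraph V) (K : Finset (TArc V)) : Prop :=
  G.IsConnectedObj K ∧ ∀ v, 2 ≤ degAt K v

end LoopedDigraph

set_option linter.unusedSectionVars false

namespace WJProof

open ChordDiagram

/-- The real sign `s` of a color in a commutative ring. -/
def sgn (R : Type*) [CommRing R] (c : JCol) : R := ((lsign c : ℤ) : R)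

/-- Coefficient of a color, given which kinds of arcs are chosen. -/
def Ccoef {R : Type*} [CommRing R] (d : R) (c : JCol) (x y : Bool) : R :=
  match c with
  | .I => if x || y then 0 else d
  | .Bp ε => - (-1 : R) ^ (if ε then 1 else 0) * (if y then -1 else d - 1)
  | .Bm ε => - (-1 : R) ^ (if ε then 1 else 0) * (if x then -1 else d - 1)

/-- Indicator that a choice is supported by the relation `al`. -/
def supp (R : Type*) [CommRing R] (al : V → V → Bool) (v : V) (o : Option V) : R :=
  match o with
  | none => 1
  | some w => if al v w then 1 else 0

/-- Monomial attached to a choice. -/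
def mono (R : Type*) [CommRing R] (ρ : V → JCol) (o : Option V) : R :=
  match o with
  | none => 1
  | some w => sgn R (ρ w)

/-- The weight of a vertex, abstractly. -/
def wt {R : Type*} [CommRing R] (d : R) (al bl : V → V → Bool) (ρ : V → JCol) (v : V) : R :=
  match ρ v with
  | .I => d
  | .Bp ε => - (-1 : R) ^ (if ε then 1 else 0) *
      (1 + ∑ w, if al v w then sgn R (ρ w) else 0) *
      (d - 1 - ∑ w, if bl v w then sgn R (ρ w) else 0)
  | .Bm ε => - (-1 : R) ^ (if ε then 1 else 0) *
      (1 + ∑ w, if bl v w then sgn R (ρ w) else 0) *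
      (d - 1 - ∑ w, if al v w then sgn R (ρ w) else 0)

lemma sum_choice {R : Type*} [CommRing R] (al : V → V → Bool) (ρ : V → JCol) (v : V)
    (F : Bool → R) :
    ∑ p : Option V, F p.isSome * (supp R al v p * mono R ρ p) =
      F false + F true * ∑ w, if al v w then sgn R (ρ w) else 0 := by
  rw [Fintype.sum_option, Finset.mul_sum]
  simp [supp, mono]

lemma wt_expand {R : Type*} [CommRing R] (d : R) (al bl : V → V → Bool) (ρ : V → JCol)
    (v : V) :
    wt d al bl ρ v = ∑ f : Option V × Option V,
      Ccoef d (ρ v) f.1.isSome f.2.isSome *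
        ((supp R al v f.1 * mono R ρ f.1) * (supp R bl v f.2 * mono R ρ f.2)) := by
  rw [Fintype.sum_prod_type]
  have h : ∀ p : Option V, ∑ q : Option V, Ccoef d (ρ v) p.isSome q.isSome *
        ((supp R al v p * mono R ρ p) * (supp R bl v q * mono R ρ q)) =
      (Ccoef d (ρ v) p.isSome false + Ccoef d (ρ v) p.isSome true *
        ∑ w, if bl v w then sgn R (ρ w) else 0) * (supp R al v p * mono R ρ p) := by
    intro p
    rw [← sum_choice bl ρ v (Ccoef d (ρ v) p.isSome), Finset.sum_mul]
    exact Finset.sum_congr rfl fun q _ => by ring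
  simp only [h]
  rw [sum_choice al ρ v (fun b => Ccoef d (ρ v) b false + Ccoef d (ρ v) b true *
        ∑ w, if bl v w then sgn R (ρ w) else 0)]
  unfold wt
  rcases ρ v with _ | ε | ε
  · simp [Ccoef]
  · cases ε <;> simp [Ccoef] <;> ring
  · cases ε <;> simp [Ccoef] <;> ring

/-- Number of arcs chosen at a vertex. -/
def cnt (o : Option V × Option V) : ℕ :=
  (if o.1.isSome then 1 else 0) + (if o.2.isSome then 1 else 0)

/-- In-degree of a vertex under a choice function. -/
def indeg (f : V → Option V × Option V) (w : V) : ℕ :=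
  ∑ v, ((if (f v).1 = some w then 1 else 0) + (if (f v).2 = some w then 1 else 0))

lemma mono_eq {R : Type*} [CommRing R] (ρ : V → JCol) (o : Option V) :
    mono R ρ o = ∏ w, sgn R (ρ w) ^ (if o = some w then 1 else 0) := by
  cases o with
  | none => simp [mono]
  | some a =>
    rw [Finset.prod_eq_single a]
    · simp [mono]
    · intro b _ hb
      simp [Ne.symm hb]
    · simp

lemma prod_mono {R : Type*} [CommRing R] (ρ : V → JCol) (f : V → Option V × Option V) :
    ∏ v, (mono R ρ (f v).1 * mono R ρ (f v).2) = ∏ w, sgn R (ρ w) ^ indeg f w := by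
  simp only [mono_eq, indeg, ← Finset.prod_mul_distrib, ← pow_add]
  rw [Finset.prod_comm]
  simp only [Finset.prod_pow_eq_pow_sum]

lemma sum_isSome (o : Option V) :
    (if o.isSome then 1 else 0 : ℕ) = ∑ w, if o = some w then 1 else 0 := by
  cases o <;> simp

lemma sum_indeg (f : V → Option V × Option V) : ∑ w, indeg f w = ∑ v, cnt (f v) := by
  unfold indeg cnt
  rw [Finset.sum_comm]
  refine Finset.sum_congr rfl fun v _ => ?_
  rw [sum_isSome, sum_isSome, Finset.sum_add_distrib]

/-- Vertex factor after summing over the colors. -/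
def Efac {R : Type*} [CommRing R] (d : R) (x y : Bool) (m : ℕ) : R :=
  ∑ c : JCol, Ccoef d c x y * sgn R c ^ m

lemma sum_JCol {R : Type*} [CommRing R] (F : JCol → R) :
    ∑ c : JCol, F c = F .I + F (.Bp false) + F (.Bp true) + F (.Bm false) + F (.Bm true) := by
  have : (univ : Finset JCol) = {.I, .Bp false, .Bp true, .Bm false, .Bm true} := by decide
  rw [this]
  simp
  ring

lemma Efac_zero {R : Type*} [CommRing R] (d : R) (x y : Bool) :
    Efac d x y 0 = if x || y then 0 else d := by
  simp only [Efac, sum_JCol, Ccoef, pow_zero]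
  cases x <;> cases y <;> simp

lemma Efac_pos {R : Type*} [CommRing R] (d : R) (x y : Bool) (m : ℕ) (hm : m ≠ 0) :
    Efac d x y m = (if y then -1 else d - 1) + (-1) ^ m * (if x then -1 else d - 1) := by
  simp only [Efac, sum_JCol, Ccoef, sgn, lsign]
  simp [hm]
  ring_nf

lemma cnt_le_of_Efac_ne {R : Type*} [CommRing R] (d : R) (o : Option V × Option V) (m : ℕ)
    (h : Efac d o.1.isSome o.2.isSome m ≠ 0) : cnt o ≤ m := by
  rcases Nat.eq_zero_or_pos m with rfl | hm
  · rw [Efac_zero] at h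
    rcases o with ⟨_ | _, _ | _⟩ <;> simp_all [cnt]
  · rw [Efac_pos _ _ _ _ hm.ne'] at h
    rcases Nat.even_or_odd m with he | ho
    · have : 2 ≤ m := by
        obtain ⟨k, hk⟩ := he
        omega
      refine le_trans ?_ this
      unfold cnt
      split_ifs <;> omega
    · rw [ho.neg_one_pow] at h
      rcases o with ⟨_ | _, _ | _⟩ <;> simp_all [cnt] <;> omega

lemma Efac_eq {R : Type*} [CommRing R] (d : R) (o : Option V × Option V) :
    Efac d o.1.isSome o.2.isSome (cnt o) =
      (if cnt o = 2 then 2 else d) * (-1) ^ (if o.2.isSome then 1 else 0) := by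
  rcases o with ⟨_ | _, _ | _⟩
  · simp [cnt, Efac_zero]
  · simp [cnt, Efac_pos]
    ring
  · simp [cnt, Efac_pos]
  · simp [cnt, Efac_pos]
    ring

/-- A choice function with matching in-degrees. -/
def Bal (f : V → Option V × Option V) : Prop := ∀ v, indeg f v = cnt (f v)

/-- A choice function is supported on allowed arcs. -/
def Sup (al bl : V → V → Bool) (f : V → Option V × Option V) : Prop :=
  ∀ v w, ((f v).1 = some w → al v w = true) ∧ ((f v).2 = some w → bl v w = true)

lemma bal_of_ne {R : Type*} [CommRing R] (d : R) (f : V → Option V × Option V)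
    (h : ∏ v, Efac d (f v).1.isSome (f v).2.isSome (indeg f v) ≠ 0) : Bal f := by
  have h1 : ∀ v ∈ (univ : Finset V), cnt (f v) ≤ indeg f v := fun v _ => by
    refine cnt_le_of_Efac_ne d _ _ fun h0 => h ?_
    exact Finset.prod_eq_zero (Finset.mem_univ v) h0
  have h2 := (Finset.sum_eq_sum_iff_of_le h1).1 (sum_indeg f).symm
  exact fun v => (h2 v (Finset.mem_univ v)).symm

open Classical in
lemma prod_supp {R : Type*} [CommRing R] (al bl : V → V → Bool) (f : V → Option V × Option V) :
    ∏ v, (supp R al v (f v).1 * supp R bl v (f v).2) = if Sup al bl f then 1 else 0 := by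
  split_ifs with h
  · refine Finset.prod_eq_one fun v _ => ?_
    have := h v
    rcases hf : f v with ⟨_ | a, _ | b⟩ <;> simp_all [supp]
  · unfold Sup at h
    push Not at h
    obtain ⟨v, w, h⟩ := h
    refine Finset.prod_eq_zero (Finset.mem_univ v) ?_
    by_cases h1 : (f v).1 = some w ∧ al v w ≠ true
    · simp [h1.1, supp, h1.2]
    · have h2 := h (by tauto)
      simp [h2.1, supp, h2.2]

open Classical in
theorem state_sum {R : Type*} [CommRing R] (d : R) (al bl : V → V → Bool) :
    ∑ ρ : V → JCol, ∏ v, wt d al bl ρ v =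
      ∑ f : V → Option V × Option V, if Sup al bl f ∧ Bal f then
        ∏ v, ((if cnt (f v) = 2 then 2 else d) * (-1) ^ (if (f v).2.isSome then 1 else 0))
      else 0 := by
  simp only [wt_expand, Fintype.prod_sum]
  rw [Finset.sum_comm]
  refine Finset.sum_congr rfl fun f _ => ?_
  have h1 : ∀ ρ : V → JCol, ∏ v, (Ccoef d (ρ v) (f v).1.isSome (f v).2.isSome *
        ((supp R al v (f v).1 * mono R ρ (f v).1) * (supp R bl v (f v).2 * mono R ρ (f v).2)))
      = (if Sup al bl f then 1 else 0) * ∏ v, (Ccoef d (ρ v) (f v).1.isSome (f v).2.isSome *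
          sgn R (ρ v) ^ indeg f v) := by
    intro ρ
    rw [← prod_supp, Finset.prod_mul_distrib (g := fun v => sgn R (ρ v) ^ indeg f v),
      ← prod_mono, ← Finset.prod_mul_distrib, ← Finset.prod_mul_distrib]
    exact Finset.prod_congr rfl fun v _ => by ring
  simp only [h1]
  rw [← Finset.mul_sum,
    ← Fintype.prod_sum (fun v c => Ccoef d c (f v).1.isSome (f v).2.isSome *
          sgn R c ^ indeg f v)]
  change _ * ∏ v, Efac d (f v).1.isSome (f v).2.isSome (indeg f v) = _
  by_cases hs : Sup al bl f
  · by_cases hb : Bal f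
    · rw [if_pos hs, if_pos ⟨hs, hb⟩, one_mul]
      refine Finset.prod_congr rfl fun v _ => ?_
      rw [hb v, Efac_eq]
    · rw [if_neg (c := Sup al bl f ∧ Bal f) (fun h => hb h.2)]
      by_contra h
      exact hb (bal_of_ne d f (fun h0 => h (by rw [h0, mul_zero])))
  · simp [hs]

/-! ### From choice functions to sets of marked arcs -/

/-- The choice of a given kind at a vertex. -/
def pick (o : Option V × Option V) (b : Bool) : Option V := if b then o.2 else o.1

/-- Marked arcs of a choice function. -/
def Tset (f : V → Option V × Option V) : Finset ((V × Bool) × V) :=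
  univ.filter fun t => pick (f t.1.1) t.1.2 = some t.2

/-- Number of marked arcs based at `v`. -/
def row (T : Finset ((V × Bool) × V)) (v : V) : ℕ := ∑ t ∈ T, if t.1.1 = v then 1 else 0

/-- Number of marked arcs pointing to `v`. -/
def col (T : Finset ((V × Bool) × V)) (v : V) : ℕ := ∑ t ∈ T, if t.2 = v then 1 else 0

/-- Number of marked arcs of kind `true` based at `v`. -/
def rout (T : Finset ((V × Bool) × V)) (v : V) : ℕ :=
  ∑ t ∈ T, if t.1.1 = v ∧ t.1.2 = true then 1 else 0

/-- Number of marked arcs of kind `true`. -/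
def aT (T : Finset ((V × Bool) × V)) : ℕ := ∑ t ∈ T, if t.1.2 = true then 1 else 0

/-- Acceptable sets of marked arcs. -/
structure AccT (al bl : V → V → Bool) (T : Finset ((V × Bool) × V)) : Prop where
  sub : ∀ t ∈ T, (if t.1.2 then bl t.1.1 t.2 else al t.1.1 t.2) = true
  le : ∀ v, row T v ≤ 2
  eq : ∀ v, col T v = row T v
  bal : ∀ v, row T v = 2 → rout T v = 1

lemma sum_Tset {f : V → Option V × Option V} (F : (V × Bool) × V → ℕ) :
    ∑ t ∈ Tset f, F t = ∑ v, ((∑ w, if (f v).1 = some w then F ((v, false), w) else 0) +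
      (∑ w, if (f v).2 = some w then F ((v, true), w) else 0)) := by
  rw [Tset, Finset.sum_filter, Fintype.sum_prod_type, Fintype.sum_prod_type]
  refine Finset.sum_congr rfl fun v _ => ?_
  rw [Fintype.sum_bool, add_comm]
  simp [pick]

lemma sum_opt (o : Option V) (k : ℕ) :
    (∑ w, if o = some w then k else 0) = if o.isSome then k else 0 := by
  cases o <;> simp

lemma row_Tset (f : V → Option V × Option V) (v : V) : row (Tset f) v = cnt (f v) := by
  rw [row, sum_Tset]
  change ∑ u, ((∑ w, if (f u).1 = some w then (if u = v then 1 else 0) else 0) +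
    (∑ w, if (f u).2 = some w then (if u = v then 1 else 0) else 0)) = _
  simp only [sum_opt]
  rw [Finset.sum_eq_single v]
  · simp [cnt]
  · intro b _ hb
    simp [hb]
  · simp

lemma rout_Tset (f : V → Option V × Option V) (v : V) :
    rout (Tset f) v = if (f v).2.isSome then 1 else 0 := by
  rw [rout, sum_Tset]
  dsimp only
  simp only [sum_opt]
  rw [Finset.sum_eq_single v]
  · simp
  · intro b _ hb
    simp [hb]
  · simp

lemma aT_Tset (f : V → Option V × Option V) :
    aT (Tset f) = ∑ v, if (f v).2.isSome then 1 else 0 := by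
  rw [aT, sum_Tset]
  dsimp only
  simp only [sum_opt]
  simp

lemma col_Tset (f : V → Option V × Option V) (v : V) : col (Tset f) v = indeg f v := by
  rw [col, sum_Tset, indeg]
  refine Finset.sum_congr rfl fun u _ => ?_
  congr 1 <;>
  · rw [Finset.sum_eq_single v]
    · simp
    · intro b _ hb
      simp [hb]
    · simp

lemma cnt_le (o : Option V × Option V) : cnt o ≤ 2 := by
  unfold cnt
  split_ifs <;> omega

lemma acc_Tset {al bl : V → V → Bool} {f : V → Option V × Option V}
    (hs : Sup al bl f) (hb : Bal f) : AccT al bl (Tset f) where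
  sub := by
    rintro ⟨⟨v, b⟩, w⟩ ht
    simp only [Tset, mem_filter, mem_univ, true_and] at ht
    cases b
    · simpa using (hs v w).1 (by simpa [pick] using ht)
    · simpa using (hs v w).2 (by simpa [pick] using ht)
  le v := by rw [row_Tset]; exact cnt_le _
  eq v := by rw [row_Tset, col_Tset, hb v]
  bal v h := by
    rw [row_Tset] at h
    rw [rout_Tset]
    unfold cnt at h
    split_ifs at h ⊢ <;> omega

lemma Tset_inj {f g : V → Option V × Option V} (h : Tset f = Tset g) : f = g := by
  have h1 : ∀ v b, pick (f v) b = pick (g v) b := by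
    intro v b
    refine Option.ext fun w => ?_
    have := congrArg (fun T => ((v, b), w) ∈ T) h
    simpa [Tset] using this
  funext v
  have h2 := h1 v false
  have h3 := h1 v true
  simp only [pick] at h2 h3
  exact Prod.ext (by simpa using h2) (by simpa using h3)

lemma acc_unique {al bl : V → V → Bool} {T : Finset ((V × Bool) × V)} (hT : AccT al bl T)
    {v : V} {b : Bool} {w w' : V} (h : ((v, b), w) ∈ T) (h' : ((v, b), w') ∈ T) : w = w' := by
  by_contra hne
  have hr : ∀ S ⊆ T, (∀ t ∈ S, t.1.1 = v) → S.card ≤ row T v := by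
    intro S hS hv
    rw [row, ← Finset.card_filter]
    exact Finset.card_le_card fun t ht => by simp [hS ht, hv t ht]
  have hpair : ({((v, b), w), ((v, b), w')} : Finset ((V × Bool) × V)).card = 2 :=
    Finset.card_pair (by simpa using hne)
  have hsub : ({((v, b), w), ((v, b), w')} : Finset ((V × Bool) × V)) ⊆ T := by
    intro t ht
    simp only [mem_insert, mem_singleton] at ht
    rcases ht with rfl | rfl <;> assumption
  have h2 : row T v = 2 := by
    have := hr _ hsub (by simp)
    have := hT.le v
    omega
  have ho := hT.bal v h2
  rw [rout, ← Finset.card_filter] at ho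
  cases b
  · obtain ⟨t, ht⟩ := Finset.card_pos.1 (by rw [ho]; exact one_pos)
    simp only [mem_filter] at ht
    have h3 := hr (insert t {((v, false), w), ((v, false), w')})
      (Finset.insert_subset ht.1 hsub) (by simp [ht.2.1])
    rw [Finset.card_insert_of_notMem, hpair] at h3
    · omega
    · intro hm
      simp only [mem_insert, mem_singleton] at hm
      rcases hm with rfl | rfl <;> simp at ht
  · have h3 : ({((v, true), w), ((v, true), w')} : Finset ((V × Bool) × V)).card ≤ 1 := by
      rw [← ho]
      refine Finset.card_le_card fun t ht => ?_
      have h4 := hsub ht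
      simp only [mem_insert, mem_singleton] at ht
      rcases ht with rfl | rfl <;> simp [h4]
    omega

open Classical in
lemma Tset_surj {al bl : V → V → Bool} {T : Finset ((V × Bool) × V)} (hT : AccT al bl T) :
    ∃ f : V → Option V × Option V, (Sup al bl f ∧ Bal f) ∧ Tset f = T := by
  have hex : ∀ vb : V × Bool, ∃ o : Option V, ∀ w, o = some w ↔ (vb, w) ∈ T := by
    rintro ⟨v, b⟩
    by_cases h : ∃ w, ((v, b), w) ∈ T
    · obtain ⟨w, hw⟩ := h
      refine ⟨some w, fun w' => ⟨?_, fun h' => ?_⟩⟩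
      · intro e
        cases e
        exact hw
      · rw [acc_unique hT hw h']
    · push Not at h
      exact ⟨none, fun w => by simp [h w]⟩
  choose g hg using hex
  have hTs : Tset (fun v => (g (v, false), g (v, true))) = T := by
    ext ⟨⟨v, b⟩, w⟩
    rw [← hg]
    cases b <;> simp [Tset, pick]
  refine ⟨fun v => (g (v, false), g (v, true)), ⟨fun v w => ⟨fun h => ?_, fun h => ?_⟩,
    fun v => ?_⟩, hTs⟩
  · simpa using hT.sub _ ((hg _ _).1 h)
  · simpa using hT.sub _ ((hg _ _).1 h)
  · have := hT.eq v
    rw [← hTs, row_Tset, col_Tset] at this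
    exact this

open Classical in
theorem sum_f_eq_sum_T {R : Type*} [CommRing R] (d : R) (al bl : V → V → Bool) :
    (∑ f : V → Option V × Option V, if Sup al bl f ∧ Bal f then
        ∏ v, ((if cnt (f v) = 2 then 2 else d) * (-1) ^ (if (f v).2.isSome then 1 else 0))
      else 0) =
    ∑ T : Finset ((V × Bool) × V), if AccT al bl T then
      2 ^ (univ.filter fun v => row T v = 2).card *
        d ^ (Fintype.card V - (univ.filter fun v => row T v = 2).card) * (-1) ^ aT T else 0 := by
  rw [← Finset.sum_filter, ← Finset.sum_filter]
  refine Finset.sum_bij (fun f _ => Tset f) ?_ ?_ ?_ ?_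
  · intro f hf
    simp only [mem_filter, mem_univ, true_and] at hf ⊢
    exact acc_Tset hf.1 hf.2
  · intro f _ g _ h
    exact Tset_inj h
  · intro T hT
    simp only [mem_filter, mem_univ, true_and] at hT
    obtain ⟨f, hf, e⟩ := Tset_surj hT
    exact ⟨f, by simpa using hf, e⟩
  · intro f _
    rw [Finset.prod_mul_distrib, Finset.prod_pow_eq_pow_sum, ← aT_Tset, Finset.prod_ite,
      Finset.prod_const, Finset.prod_const]
    simp only [row_Tset]
    congr 3
    rw [← Finset.card_univ, ← Finset.card_filter_add_card_filter_not (s := univ)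
      (fun v => cnt (f v) = 2)]
    omega

/-! ### From sets of marked arcs to acceptable objects -/

section Diagram

variable {n : ℕ} (D : ChordDiagram n)

/-- The point `p` lies below the chord `w`. -/
def inc (p : Fin (2 * n)) (w : Fin n) : Bool := decide (D.l w < p ∧ ¬ D.r w < p)

lemma l_ne_r (v w : Fin n) : D.l v ≠ D.r w := by
  intro h
  obtain ⟨i, _, hi⟩ := D.cover (D.l v)
  have h1 := hi v (Or.inl rfl)
  have h2 := hi w (Or.inr h.symm)
  have : v = w := h1.trans h2.symm
  subst this
  exact (D.lr v).ne h

lemma r_inj {v w : Fin n} (h : D.r v = D.r w) : v = w := by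
  obtain ⟨i, _, hi⟩ := D.cover (D.r v)
  exact (hi v (Or.inr rfl)).trans (hi w (Or.inr h.symm)).symm

lemma inc_l (v w : Fin n) :
    inc D (D.l v) w = true ↔ D.Contained v w ∨ (w < v ∧ D.Intersect w v) := by
  have h1 := D.mono.lt_iff_lt (a := w) (b := v)
  have h2 := D.lr v
  have h3 := D.lr w
  have h4 := l_ne_r D v w
  have h5 : D.r v = D.r w → v = w := r_inj D
  have h6 : v = w → D.l v = D.l w := fun h => by rw [h]
  simp only [inc, decide_eq_true_eq, Contained, Intersect, ← h1]
  grind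

lemma inc_r (v w : Fin n) :
    inc D (D.r v) w = true ↔ v = w ∨ (v < w ∧ D.Intersect v w) ∨ D.Contained v w := by
  have h1 := D.mono.lt_iff_lt (a := v) (b := w)
  have h2 := D.lr v
  have h3 := D.lr w
  have h4 := l_ne_r D w v
  have h5 : D.r v = D.r w → v = w := r_inj D
  have h6 : v = w → D.l v = D.l w := fun h => by rw [h]
  have h7 : D.l v = D.l w → v = w := fun h => D.mono.injective h
  have h8 : v = w → D.r v = D.r w := fun h => by rw [h]
  simp only [inc, decide_eq_true_eq, Contained, Intersect, ← h1]
  grind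

/-- Allowed arcs. -/
abbrev al (v w : Fin n) : Bool := inc D (D.l v) w

/-- Allowed arcs. -/
abbrev bl (v w : Fin n) : Bool := inc D (D.r v) w

/-- Marked arc of a thickened arc. -/
def phi (t : TArc (Fin n)) : (Fin n × Bool) × Fin n :=
  if t.2 then ((t.1.1, true), t.1.2)
  else if D.Contained t.1.1 t.1.2 then ((t.1.1, false), t.1.2) else ((t.1.2, false), t.1.1)

/-- Thickened arc of a marked arc. -/
def psi (t : (Fin n × Bool) × Fin n) : TArc (Fin n) :=
  if t.1.2 then ((t.1.1, t.2), true)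
  else if D.Contained t.1.1 t.2 then ((t.1.1, t.2), false) else ((t.2, t.1.1), false)

/-- Valid thickened arcs. -/
def valid (t : TArc (Fin n)) : Prop := t.1 ∈ (LID D).arcs ∧ (t.1.1 = t.1.2 → t.2 = true)

/-- Valid marked arcs. -/
def validT (t : (Fin n × Bool) × Fin n) : Prop :=
  (if t.1.2 then bl D t.1.1 t.2 else al D t.1.1 t.2) = true

lemma not_cont_of_lt {v w : Fin n} (h : v < w) : ¬ D.Contained v w := fun hc =>
  lt_asymm hc.1 (D.mono h)

lemma not_cont_of_int {v w : Fin n} (h : D.Intersect v w) : ¬ D.Contained v w := by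
  simp only [Contained, Intersect] at *
  omega

lemma mem_red (p : Fin n × Fin n) : p ∈ (LID D).red ↔ D.Contained p.1 p.2 := by
  simp [LID]

lemma mem_arcs (p : Fin n × Fin n) : p ∈ (LID D).arcs ↔
    p.1 = p.2 ∨ (p.1 < p.2 ∧ D.Intersect p.1 p.2) ∨ D.Contained p.1 p.2 := by
  simp only [LID, mem_filter, mem_univ, true_and]

lemma cont_ne {v w : Fin n} (h : D.Contained v w) : v ≠ w := by
  rintro rfl
  exact lt_irrefl _ h.1

lemma phi_psi {t : (Fin n × Bool) × Fin n} (h : validT D t) : phi D (psi D t) = t := by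
  obtain ⟨⟨v, b⟩, w⟩ := t
  cases b
  · simp only [validT, Bool.false_eq_true, if_false, inc_l] at h
    by_cases hc : D.Contained v w
    · simp only [psi, phi, Bool.false_eq_true, if_false, if_pos hc]
    · have hw : w < v := by tauto
      simp only [psi, phi, Bool.false_eq_true, if_false, if_neg hc,
        if_neg (not_cont_of_lt D hw)]
  · simp [psi, phi]

lemma valid_psi {t : (Fin n × Bool) × Fin n} (h : validT D t) : valid D (psi D t) := by
  obtain ⟨⟨v, b⟩, w⟩ := t
  cases b
  · simp only [validT, Bool.false_eq_true, if_false, inc_l] at h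
    by_cases hc : D.Contained v w
    · simp only [psi, valid, Bool.false_eq_true, if_false, if_pos hc, mem_arcs]
      exact ⟨Or.inr (Or.inr hc), fun e => absurd e (cont_ne D hc)⟩
    · have hw : w < v ∧ D.Intersect w v := by tauto
      simp only [psi, valid, Bool.false_eq_true, if_false, if_neg hc, mem_arcs]
      exact ⟨Or.inr (Or.inl hw), fun e => absurd e hw.1.ne⟩
  · simp only [validT, if_true, inc_r] at h
    simp only [psi, valid, if_true, mem_arcs]
    exact ⟨h, fun _ => trivial⟩

lemma psi_phi {t : TArc (Fin n)} (h : valid D t) : validT D (phi D t) ∧ psi D (phi D t) = t := by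
  obtain ⟨⟨v, w⟩, b⟩ := t
  cases b
  · simp only [valid, mem_arcs] at h
    by_cases hc : D.Contained v w
    · simp only [phi, psi, validT, Bool.false_eq_true, if_false, if_pos hc, inc_l]
      exact ⟨Or.inl hc, trivial⟩
    · have hw : v < w ∧ D.Intersect v w := by
        rcases h with ⟨h1 | h1 | h1, h2⟩
        · exact absurd (h2 h1) (by simp)
        · exact h1
        · exact absurd h1 hc
      have hc' : ¬ D.Contained w v := not_cont_of_int D (Or.symm hw.2)
      simp only [phi, psi, validT, Bool.false_eq_true, if_false, if_neg hc, if_neg hc', inc_l]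
      exact ⟨Or.inr hw, trivial⟩
  · simp only [valid, mem_arcs] at h
    simp only [phi, psi, validT, if_true, inc_r]
    exact ⟨h.1, trivial⟩

lemma tvert_eq (t : TArc (Fin n)) : (LID D).tvert t = (phi D t).1.1 := by
  obtain ⟨⟨v, w⟩, b⟩ := t
  unfold LoopedDigraph.tvert
  simp only [mem_red, phi]
  cases b
  · by_cases hc : D.Contained v w
    · simp only [if_pos hc, Bool.false_eq_true, if_false]
    · simp only [if_neg hc, Bool.false_eq_true, if_false]
  · simp

lemma src_eq {t : TArc (Fin n)} (h : valid D t) :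
    (LID D).src t = (LID D).tvert t ↔ (phi D t).1.2 = true := by
  obtain ⟨⟨v, w⟩, b⟩ := t
  have hb := h.2
  unfold LoopedDigraph.tvert LoopedDigraph.src
  simp only [mem_red, phi]
  cases b
  · have hne : v ≠ w := fun e => by simpa using hb e
    by_cases hc : D.Contained v w
    · have h1 : D.Contained v w ∧ True := ⟨hc, trivial⟩
      simp only [if_pos hc, Bool.false_eq_true, if_false, if_pos h1, hne.symm]
    · simp only [hc, false_and, if_false]
      simp [hne]
  · by_cases hc : D.Contained v w <;> simp [-not_and, hc]

lemma ends_eq (t : TArc (Fin n)) (v : Fin n) :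
    ((if t.1.1 = v then 1 else 0) + (if t.1.2 = v then 1 else 0) : ℕ) =
      (if (phi D t).1.1 = v then 1 else 0) + (if (phi D t).2 = v then 1 else 0) := by
  unfold phi
  split_ifs <;> rfl

lemma psi_injOn {T : Finset ((Fin n × Bool) × Fin n)} (hT : ∀ t ∈ T, validT D t) :
    Set.InjOn (psi D) (T : Set ((Fin n × Bool) × Fin n)) := by
  intro s hs t ht e
  rw [← phi_psi D (hT s hs), ← phi_psi D (hT t ht), e]

lemma degAt_image {T : Finset ((Fin n × Bool) × Fin n)} (hT : ∀ t ∈ T, validT D t)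
    (v : Fin n) : degAt (T.image (psi D)) v = row T v + col T v := by
  rw [degAt, Finset.sum_image (psi_injOn D hT), row, col, ← Finset.sum_add_distrib]
  refine Finset.sum_congr rfl fun t ht => ?_
  rw [ends_eq D, phi_psi D (hT t ht)]

lemma thickAt_image {T : Finset ((Fin n × Bool) × Fin n)} (hT : ∀ t ∈ T, validT D t)
    (v : Fin n) : (LID D).thickAt (T.image (psi D)) v = row T v := by
  rw [LoopedDigraph.thickAt, Finset.card_filter, Finset.sum_image (psi_injOn D hT), row]
  refine Finset.sum_congr rfl fun t ht => ?_
  rw [tvert_eq, phi_psi D (hT t ht)]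

lemma outThickAt_image {T : Finset ((Fin n × Bool) × Fin n)} (hT : ∀ t ∈ T, validT D t)
    (v : Fin n) : (LID D).outThickAt (T.image (psi D)) v = rout T v := by
  rw [LoopedDigraph.outThickAt, Finset.card_filter, Finset.sum_image (psi_injOn D hT), rout]
  refine Finset.sum_congr rfl fun t ht => if_congr ?_ rfl rfl
  have h1 := src_eq D (valid_psi D (hT t ht))
  have h2 := tvert_eq D (psi D t)
  rw [phi_psi D (hT t ht)] at h1 h2
  rw [← h1, ← h2]
  constructor
  · rintro ⟨a, b⟩
    exact ⟨a, b.trans a.symm⟩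
  · rintro ⟨a, b⟩
    exact ⟨a, b.trans a⟩

lemma aK_image {T : Finset ((Fin n × Bool) × Fin n)} (hT : ∀ t ∈ T, validT D t) :
    (LID D).aK (T.image (psi D)) = aT T := by
  rw [LoopedDigraph.aK, Finset.card_filter, Finset.sum_image (psi_injOn D hT), aT]
  refine Finset.sum_congr rfl fun t ht => if_congr ?_ rfl rfl
  rw [src_eq D (valid_psi D (hT t ht)), phi_psi D (hT t ht)]

lemma acc_iff {T : Finset ((Fin n × Bool) × Fin n)} (hT : ∀ t ∈ T, validT D t) :
    (LID D).IsAcceptable (T.image (psi D)) ↔ AccT (al D) (bl D) T := by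
  constructor
  · intro h
    have h1 : ∀ v, col T v = row T v := fun v => by
      have := h.half_thick v
      rw [degAt_image D hT, thickAt_image D hT] at this
      omega
    refine ⟨hT, fun v => ?_, h1, fun v hv => ?_⟩
    · have := h.deg024 v
      rw [degAt_image D hT, h1] at this
      omega
    · have := h.balance v
      rw [thickAt_image D hT, outThickAt_image D hT] at this
      exact this hv
  · intro h
    have hv : ∀ t ∈ T.image (psi D), valid D t := by
      intro t ht
      obtain ⟨s, hs, rfl⟩ := Finset.mem_image.1 ht
      exact valid_psi D (hT s hs)
    refine ⟨fun t ht => (hv t ht).1, fun t ht => (hv t ht).2, fun v => ?_, fun v => ?_,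
      fun v => ?_⟩
    · rw [degAt_image D hT, h.eq]
      have := h.le v
      omega
    · rw [degAt_image D hT, thickAt_image D hT, h.eq]
      omega
    · rw [thickAt_image D hT, outThickAt_image D hT]
      exact h.bal v

lemma deg4_image {T : Finset ((Fin n × Bool) × Fin n)} (hT : AccT (al D) (bl D) T) :
    deg4 (T.image (psi D)) = (univ.filter fun v => row T v = 2).card := by
  unfold deg4
  congr 1
  refine Finset.filter_congr fun v _ => ?_
  rw [degAt_image D hT.sub, hT.eq]
  omega

open Classical in
theorem sum_T_eq_sum_K {R : Type*} [CommRing R] (d : R) :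
    (∑ T : Finset ((Fin n × Bool) × Fin n), if AccT (al D) (bl D) T then
      2 ^ (univ.filter fun v => row T v = 2).card *
        d ^ (Fintype.card (Fin n) - (univ.filter fun v => row T v = 2).card) * (-1) ^ aT T
      else 0) =
    ∑ K : Finset (TArc (Fin n)), if (LID D).IsAcceptable K then
      2 ^ deg4 K * d ^ (n - deg4 K) * (-1) ^ (LID D).aK K else 0 := by
  rw [← Finset.sum_filter, ← Finset.sum_filter]
  refine Finset.sum_bij (fun T _ => T.image (psi D)) ?_ ?_ ?_ ?_
  · intro T hT
    simp only [mem_filter, mem_univ, true_and] at hT ⊢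
    exact (acc_iff D hT.sub).2 hT
  · intro S hS T hT h
    simp only [mem_filter, mem_univ, true_and] at hS hT
    have key : ∀ U : Finset ((Fin n × Bool) × Fin n), AccT (al D) (bl D) U →
        (U.image (psi D)).image (phi D) = U := by
      intro U hU
      rw [Finset.image_image]
      conv_rhs => rw [← Finset.image_id (s := U)]
      exact Finset.image_congr fun t ht => phi_psi D (hU.sub t ht)
    rw [← key S hS, ← key T hT]
    exact congrArg _ h
  · intro K hK
    simp only [mem_filter, mem_univ, true_and] at hK
    have hv : ∀ t ∈ K, valid D t := fun t ht => ⟨hK.mem_arcs t ht, hK.loop_thick t ht⟩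
    have e : (K.image (phi D)).image (psi D) = K := by
      rw [Finset.image_image]
      conv_rhs => rw [← Finset.image_id (s := K)]
      exact Finset.image_congr fun t ht => (psi_phi D (hv t ht)).2
    have hT : ∀ t ∈ K.image (phi D), validT D t := by
      intro t ht
      obtain ⟨s, hs, rfl⟩ := Finset.mem_image.1 ht
      exact (psi_phi D (hv s hs)).1
    refine ⟨K.image (phi D), ?_, e⟩
    simp only [mem_filter, mem_univ, true_and]
    rw [← acc_iff D hT, e]
    exact hK
  · intro T hT
    simp only [mem_filter, mem_univ, true_and] at hT
    rw [deg4_image D hT, aK_image D hT.sub, Fintype.card_fin]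

/-! ### The weight of a chord -/

lemma kOf_eq (ρ : Fin n → JCol) (p : Fin (2 * n)) :
    D.kOf ρ p = ∑ w, if inc D p w then lsign (ρ w) else 0 := by
  unfold kOf delta
  rw [Finset.sum_comm]
  refine Finset.sum_congr rfl fun w _ => ?_
  rw [Finset.sum_add_distrib, Finset.sum_ite_eq, Finset.sum_ite_eq]
  have := D.lr w
  simp only [mem_filter, mem_univ, true_and, inc, decide_eq_true_eq]
  by_cases h1 : D.l w < p <;> by_cases h2 : D.r w < p
  · simp [h1, h2]
  · simp [h1, h2]
  · exact absurd (this.trans h2) h1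
  · simp [h1, h2]

lemma kOf_cast (ρ : Fin n → JCol) (p : Fin (2 * n)) :
    ((D.kOf ρ p : ℤ) : Polynomial ℚ) =
      ∑ w, if inc D p w then sgn (Polynomial ℚ) (ρ w) else 0 := by
  rw [kOf_eq, Int.cast_sum]
  refine Finset.sum_congr rfl fun w _ => ?_
  split_ifs <;> simp [sgn]

lemma omega_eq (ρ : Fin n → JCol) (v : Fin n) :
    D.omega ρ v = wt (Polynomial.X + 2) (al D) (bl D) ρ v := by
  have h : (Polynomial.X + 2 - 1 : Polynomial ℚ) = Polynomial.X + 1 := by ring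
  unfold omega wt
  simp only [kOf_cast, h]

open Classical in
theorem WJ_eq : D.WJ = ∑ K : Finset (TArc (Fin n)), if (LID D).IsAcceptable K then
      2 ^ deg4 K * (Polynomial.X + 2 : Polynomial ℚ) ^ (n - deg4 K) * (-1) ^ (LID D).aK K
      else 0 := by
  unfold WJ
  simp only [omega_eq]
  rw [state_sum, sum_f_eq_sum_T, sum_T_eq_sum_K]

end Diagram

end WJProof

open Classical in
/-- **Corollary.** After the change of variable `λ = d − 2`, the coefficient of
`d^{n−m}` in `W_J(D)` is `2^m Σ_K (−1)^{a(K)}`, summed over all acceptable objects `K`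
for `LID(D)` with `deg₄(K) = m`. -/
theorem coeff_WJ_eq_acceptable_sum {n m : ℕ} (D : ChordDiagram n) (hm : m ≤ n) :
    (D.WJ.comp (Polynomial.X - 2)).coeff (n - m) =
      2 ^ m * ∑ K : Finset (TArc (Fin n)),
        if (LID D).IsAcceptable K ∧ deg4 K = m
        then ((-1 : ℚ) ^ ((LID D).aK K)) else 0 := by
  rw [WJProof.WJ_eq]
  simp only [← Polynomial.coe_compRingHom_apply, map_sum]
  rw [Polynomial.finsetSum_coeff, Finset.mul_sum]
  refine Finset.sum_congr rfl fun K _ => ?_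
  have hle : deg4 K ≤ n := by
    refine (Finset.card_le_univ _).trans ?_
    rw [Fintype.card_fin]
  by_cases hK : (LID D).IsAcceptable K
  · have hX : ((Polynomial.X : Polynomial ℚ) + 2).comp (Polynomial.X - 2) = Polynomial.X := by
      simp
    have hC : (2 ^ deg4 K * (Polynomial.X : Polynomial ℚ) ^ (n - deg4 K) *
        (-1) ^ (LID D).aK K) =
        Polynomial.C (2 ^ deg4 K * (-1) ^ (LID D).aK K) * Polynomial.X ^ (n - deg4 K) := by
      simp only [map_mul, map_pow, map_neg, map_one, map_ofNat]
      ring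
    rw [if_pos hK, map_mul, map_mul, map_pow, map_pow, map_pow, map_neg, map_one, map_ofNat,
      Polynomial.coe_compRingHom_apply, hX, hC, Polynomial.coeff_C_mul_X_pow]
    by_cases hd : deg4 K = m
    · rw [if_pos (by rw [hd]), if_pos ⟨hK, hd⟩, hd]
    · rw [if_neg (by omega), if_neg (fun h => hd h.2), mul_zero]
  · simp [hK]
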